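/- Soundness of the postcondition inference calculus: if the inferred postcondition post(s, p) is defined (i.e. the side conditions of the calculus rules, such as p ⊨ safe(e) for assignments, p ⊨ safe(g) for conditionals, and the invariant/variant conditions for annotated while-loops, all hold), then the Hoare triple {p} s {post(s, p)} is sound: for every state σ with σ ⊨ p there exists σ' with ⟨σ, s⟩ ⇓ σ' and σ' ⊨ post(s, p). Hence the inferred postconditions are correct by construction and their run-time checks can be omitted. -/

import Mathlib

namespace Pest

/-- Program variables. -/
abbrev Var := String

/-- Values. -/
abbrev Val := Int

/-- States map variables to values. -/
abbrev State := Var → Val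

/-- State update `σ[v ↦ n]`. -/
def State.upd (σ : State) (v : Var) (n : Val) : State :=
  fun w => if w = v then n else σ w

/-- Expressions: a partial evaluation `⟦e⟧σ` together with a safety predicate
    `safe(e)` such that `σ ⊨ safe(e)` implies `⟦e⟧σ` is defined. -/
structure Expr (α : Type) where
  eval : State → Option α
  safe : State → Prop
  safe_eval : ∀ σ : State, safe σ → (eval σ).isSome

abbrev IExpr := Expr Val
abbrev BExpr := Expr Bool

/-- Predicates on states; `σ ⊨ p` is `p σ`. -/
abbrev Pred := State → Prop

/-- Semantic entailment `p ⊨ q`. -/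
def Entails (p q : Pred) : Prop := ∀ σ : State, p σ → q σ

/-- Pest statements, including local variable declarations `local v ← e`.
    A while-loop `while g :?! inv :# var do s od` carries an invariant
    annotation `inv` and an integer variant annotation `var`. -/
inductive Stmt where
  | skip : Stmt
  | assign : Var → IExpr → Stmt
  | locl : Var → IExpr → Stmt
  | seq : Stmt → Stmt → Stmt
  | ite : BExpr → Stmt → Stmt → Stmt
  | whileLoop : BExpr → BExpr → IExpr → Stmt → Stmt   -- guard, invariant, variant, body

/-- The local variables declared by a statement. -/
def localVars : Stmt → List Var
  | .skip => []
  | .assign _ _ => []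
  | .locl v _ => [v]
  | .seq s₁ s₂ => localVars s₁ ++ localVars s₂
  | .ite _ s₁ s₂ => localVars s₁ ++ localVars s₂
  | .whileLoop _ _ _ s => localVars s

/-- Existential closure `∃ V. p` of a predicate over a list of variables:
    `σ` satisfies it iff some reassignment of the variables in `V` yields a
    state satisfying `p`. -/
def ExClose (V : List Var) (p : Pred) : Pred :=
  fun σ => ∃ ρ : Var → Val, p (fun w => if w ∈ V then ρ w else σ w)

/-- Big-step operational semantics `⟨σ, s⟩ ⇓ σ'`, in which annotations act as
    assertions. -/
inductive BigStep : State → Stmt → State → Prop where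
  | skip (σ : State) : BigStep σ .skip σ
  | assign {σ : State} {v : Var} {e : IExpr} {n : Val} :
      e.eval σ = some n → BigStep σ (.assign v e) (σ.upd v n)
  | locl {σ : State} {v : Var} {e : IExpr} {n : Val} :
      e.eval σ = some n → BigStep σ (.locl v e) (σ.upd v n)
  | seq {σ σ' σ'' : State} {s₁ s₂ : Stmt} :
      BigStep σ s₁ σ' → BigStep σ' s₂ σ'' → BigStep σ (.seq s₁ s₂) σ''
  | iteTrue {σ σ' : State} {g : BExpr} {s₁ s₂ : Stmt} :
      g.eval σ = some true → BigStep σ s₁ σ' → BigStep σ (.ite g s₁ s₂) σ'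
  | iteFalse {σ σ' : State} {g : BExpr} {s₁ s₂ : Stmt} :
      g.eval σ = some false → BigStep σ s₂ σ' → BigStep σ (.ite g s₁ s₂) σ'
  | whileFalse {σ : State} {g inv : BExpr} {vr : IExpr} {s : Stmt} :
      inv.eval σ = some true → g.eval σ = some false →
      BigStep σ (.whileLoop g inv vr s) σ
  | whileTrue {σ σ' σ'' : State} {g inv : BExpr} {vr : IExpr} {s : Stmt} {n n' : Val} :
      inv.eval σ = some true → g.eval σ = some true →
      vr.eval σ = some n → 0 < n →
      BigStep σ s σ' →
      vr.eval σ' = some n' → n' < n →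
      BigStep σ' (.whileLoop g inv vr s) σ'' →
      BigStep σ (.whileLoop g inv vr s) σ''

/-- The postcondition inference calculus: `PostCalc s p q` means that
    `post(s, p)` is defined (all side conditions of the calculus rules hold)
    and equals `q`.  Rule Q-ASSIGN requires `p ⊨ safe(e)`; Q-IF requires
    `p ⊨ safe(g)` and existentially closes each branch's postcondition over
    its local variables; Q-WHILE requires the invariant/variant side
    conditions, with the ghost variable `var₀` recording the entry value of
    the variant rendered by the index `n`. -/
inductive PostCalc : Stmt → Pred → Pred → Prop where
  | skip {p : Pred} : PostCalc .skip p p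
  | assign {p : Pred} {v : Var} {e : IExpr} :
      Entails p e.safe →
      PostCalc (.assign v e) p
        (fun σ => ∃ n : Val, p (σ.upd v n) ∧ e.eval (σ.upd v n) = some (σ v))
  | locl {p : Pred} {v : Var} {e : IExpr} :
      Entails p e.safe →
      PostCalc (.locl v e) p
        (fun σ => ∃ n : Val, p (σ.upd v n) ∧ e.eval (σ.upd v n) = some (σ v))
  | seq {p r q : Pred} {s₁ s₂ : Stmt} :
      PostCalc s₁ p r → PostCalc s₂ r q → PostCalc (.seq s₁ s₂) p q
  | ite {p q₁ q₂ : Pred} {g : BExpr} {s₁ s₂ : Stmt} :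
      Entails p g.safe →
      PostCalc s₁ (fun σ => p σ ∧ g.eval σ = some true) q₁ →
      PostCalc s₂ (fun σ => p σ ∧ g.eval σ = some false) q₂ →
      PostCalc (.ite g s₁ s₂) p
        (fun σ => ExClose (localVars s₁) q₁ σ ∨ ExClose (localVars s₂) q₂ σ)
  | whileLoop {p : Pred} {g inv : BExpr} {vr : IExpr} {s : Stmt}
      (q' : Val → Pred) :
      (∀ σ : State, inv.safe σ) →
      Entails (fun σ => inv.eval σ = some true) vr.safe →
      Entails (fun σ => inv.eval σ = some true) g.safe →
      Entails p (fun σ => inv.eval σ = some true) →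
      Entails (fun σ => inv.eval σ = some true ∧ g.eval σ = some true)
              (fun σ => ∃ n : Val, vr.eval σ = some n ∧ 0 < n) →
      (∀ n : Val, PostCalc s
        (fun σ => inv.eval σ = some true ∧ g.eval σ = some true ∧ vr.eval σ = some n)
        (q' n)) →
      (∀ n : Val, Entails (q' n) (fun σ => inv.eval σ = some true)) →
      (∀ n : Val, Entails (q' n) (fun σ => ∃ m : Val, vr.eval σ = some m ∧ m < n)) →
      PostCalc (.whileLoop g inv vr s) p
        (fun σ => inv.eval σ = some true ∧ g.eval σ = some false)

theorem Expr.exists_eval {α : Type} (e : Expr α) {σ : State} (h : e.safe σ) :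
    ∃ a, e.eval σ = some a :=
  Option.isSome_iff_exists.mp (e.safe_eval σ h)

theorem State.upd_upd_self (σ : State) (v : Var) (n : Val) :
    (σ.upd v n).upd v (σ v) = σ := by
  funext w
  by_cases hw : w = v <;> simp [State.upd, hw]

/-- Strongest-postcondition property shared by assignments and local declarations. -/
theorem upd_assign_post {p : Pred} {e : IExpr} {σ : State} {n : Val} (v : Var)
    (hp : p σ) (hn : e.eval σ = some n) :
    ∃ m : Val, p ((σ.upd v n).upd v m) ∧
      e.eval ((σ.upd v n).upd v m) = some (σ.upd v n v) := by
  refine ⟨σ v, ?_, ?_⟩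
  · rwa [State.upd_upd_self]
  · rw [State.upd_upd_self, hn]
    simp [State.upd]

theorem ExClose.of_pred (V : List Var) {p : Pred} {σ : State} (h : p σ) : ExClose V p σ :=
  ⟨σ, by simpa using h⟩

/-- Total correctness of a loop whose body preserves the invariant and decreases the variant. -/
theorem exists_bigStep_whileLoop {g inv : BExpr} {vr : IExpr} {s : Stmt}
    (hg : Entails (fun σ => inv.eval σ = some true) g.safe)
    (hpos : Entails (fun σ => inv.eval σ = some true ∧ g.eval σ = some true)
      (fun σ => ∃ n : Val, vr.eval σ = some n ∧ 0 < n))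
    (hbody : ∀ (σ : State) (n : Val),
      inv.eval σ = some true → g.eval σ = some true → vr.eval σ = some n →
      ∃ σ', BigStep σ s σ' ∧ inv.eval σ' = some true ∧ ∃ m, vr.eval σ' = some m ∧ m < n)
    (σ : State) (hinv : inv.eval σ = some true) :
    ∃ σ', BigStep σ (.whileLoop g inv vr s) σ' ∧
      inv.eval σ' = some true ∧ g.eval σ' = some false := by
  induction hk : ((vr.eval σ).getD 0).toNat using Nat.strong_induction_on generalizing σ with
  | _ k ih =>
    obtain ⟨b, hb⟩ := g.exists_eval (hg σ hinv)
    cases b with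
    | false => exact ⟨σ, .whileFalse hinv hb, hinv, hb⟩
    | true =>
      obtain ⟨n, hn, hn0⟩ := hpos σ ⟨hinv, hb⟩
      obtain ⟨σ₁, hs, hinv₁, m, hm, hmn⟩ := hbody σ n hinv hb hn
      have hlt : ((vr.eval σ₁).getD 0).toNat < k := by
        rw [← hk, hn, hm]
        exact (Int.toNat_lt_toNat hn0).mpr hmn
      obtain ⟨σ₂, hloop, hpost⟩ := ih _ hlt σ₁ hinv₁ rfl
      exact ⟨σ₂, .whileTrue hinv hb hn hn0 hs hm hmn hloop, hpost⟩

/-- Soundness of the postcondition inference calculus: whenever `post(s, p)`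
    is defined, the triple `{p} s {post(s, p)}` is sound: from every state
    satisfying `p`, `s` executes normally and terminates in a state satisfying
    `post(s, p)`. -/
theorem postcalc_sound {s : Stmt} {p q : Pred} (h : PostCalc s p q) :
    ∀ σ : State, p σ → ∃ σ' : State, BigStep σ s σ' ∧ q σ' := by
  induction h with
  | skip => exact fun σ hp => ⟨σ, .skip σ, hp⟩
  | @assign p v e he =>
    intro σ hp
    obtain ⟨n, hn⟩ := e.exists_eval (he σ hp)
    exact ⟨σ.upd v n, .assign hn, upd_assign_post v hp hn⟩
  | @locl p v e he =>
    intro σ hp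
    obtain ⟨n, hn⟩ := e.exists_eval (he σ hp)
    exact ⟨σ.upd v n, .locl hn, upd_assign_post v hp hn⟩
  | seq _ _ ih₁ ih₂ =>
    intro σ hp
    obtain ⟨σ₁, h₁, hr⟩ := ih₁ σ hp
    obtain ⟨σ₂, h₂, hq⟩ := ih₂ σ₁ hr
    exact ⟨σ₂, .seq h₁ h₂, hq⟩
  | @ite p q₁ q₂ g s₁ s₂ hg _ _ ih₁ ih₂ =>
    intro σ hp
    obtain ⟨b, hb⟩ := g.exists_eval (hg σ hp)
    cases b with
    | true =>
      obtain ⟨σ', hs, hq⟩ := ih₁ σ ⟨hp, hb⟩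
      exact ⟨σ', .iteTrue hb hs, .inl (.of_pred _ hq)⟩
    | false =>
      obtain ⟨σ', hs, hq⟩ := ih₂ σ ⟨hp, hb⟩
      exact ⟨σ', .iteFalse hb hs, .inr (.of_pred _ hq)⟩
  | whileLoop q' _ _ hg hp hpos _ hinv hvar ih =>
    intro σ hσ
    refine exists_bigStep_whileLoop hg hpos (fun τ n hi hgt hn => ?_) σ (hp σ hσ)
    obtain ⟨τ', hs, hq⟩ := ih n τ ⟨hi, hgt, hn⟩
    exact ⟨τ', hs, hinv n τ' hq, hvar n τ' hq⟩

end Pest
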